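/- Let B : [0,∞) → ℝ be a continuous function and let ℓ : ℝ × [0,∞) → [0,∞) be a jointly continuous function such that for every y ∈ ℝ and every t ≥ 0, ℓ(y,t) = lim_{ε→0⁺} (2ε)⁻¹ · Leb{u ∈ [0,t] : |B(u) − y| < ε}, and such that for every y ∈ ℝ, sup_{t≥0} ℓ(y,t) = ∞. Fix real constants c ≠ 0 and d > 0. Then the map t ↦ (c·B(t), d·ℓ(B(t), t)) is continuous on [0,∞) and its range is all of ℝ × [0,∞); moreover, if additionally for every t ≥ 0 the function y ↦ ℓ(y,t) is a density with respect to Lebesgue measure of the occupation measure A ↦ Leb{u ∈ [0,t] : B(u) ∈ A}, then the two-dimensional Lebesgue measure of {(c·B(u), d·ℓ(B(u), u)) : u ∈ [0,t]} equals |c|·d·t for every t ≥ 0. -/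

import Mathlib

open MeasureTheory Filter Set

/-- The occupation-density property: `ℓ y t` is the limit as `ε → 0⁺` of
`(2ε)⁻¹ · Leb {u ∈ [0,t] : |B u − y| < ε}`. -/
def OccupationDensity (B : ℝ → ℝ) (ℓ : ℝ → ℝ → ℝ) : Prop :=
  ∀ y t : ℝ, 0 ≤ t →
    Tendsto (fun ε : ℝ =>
        (volume {u ∈ Icc (0:ℝ) t | |B u - y| < ε}).toReal / (2 * ε))
      (nhdsWithin 0 (Ioi 0)) (nhds (ℓ y t))

/-- For each `t ≥ 0`, `y ↦ ℓ y t` is a density, with respect to Lebesgue measure,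
of the occupation measure `A ↦ Leb {u ∈ [0,t] : B u ∈ A}`. -/
def OccupationMeasureDensity (B : ℝ → ℝ) (ℓ : ℝ → ℝ → ℝ) : Prop :=
  ∀ t : ℝ, 0 ≤ t → ∀ A : Set ℝ, MeasurableSet A →
    volume {u ∈ Icc (0:ℝ) t | B u ∈ A} = ∫⁻ y in A, ENNReal.ofReal (ℓ y t)

namespace OccupationDensity

variable {B : ℝ → ℝ} {ℓ : ℝ → ℝ → ℝ}

theorem apply_zero (hocc : OccupationDensity B ℓ) (y : ℝ) : ℓ y 0 = 0 := by
  refine tendsto_nhds_unique (hocc y 0 le_rfl) (tendsto_const_nhds.congr fun ε => ?_)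
  have h0 : volume {u ∈ Icc (0 : ℝ) 0 | |B u - y| < ε} = 0 :=
    measure_mono_null (sep_subset _ _) (by simp)
  rw [h0, ENNReal.toReal_zero, zero_div]

theorem mono (hocc : OccupationDensity B ℓ) (y : ℝ) {s t : ℝ} (hs : 0 ≤ s) (hst : s ≤ t) :
    ℓ y s ≤ ℓ y t := by
  refine le_of_tendsto_of_tendsto (hocc y s hs) (hocc y t (hs.trans hst)) ?_
  filter_upwards [self_mem_nhdsWithin] with ε hε
  have hε' : 0 < ε := hε
  gcongr
  exact ((measure_mono (sep_subset _ _)).trans_lt measure_Icc_lt_top).ne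

/-- The local time at `y` does not grow while `B` stays away from `y`. -/
theorem eq_of_le_abs_sub (hocc : OccupationDensity B ℓ) {y s t δ : ℝ} (hs : 0 ≤ s) (hst : s ≤ t)
    (hδ : 0 < δ) (h : ∀ u ∈ Icc s t, δ ≤ |B u - y|) : ℓ y t = ℓ y s := by
  refine tendsto_nhds_unique (hocc y t (hs.trans hst)) ((hocc y s hs).congr' ?_)
  filter_upwards [Ioo_mem_nhdsGT hδ] with ε hε
  congr 3
  ext u
  refine ⟨fun hu => ⟨⟨hu.1.1, hu.1.2.trans hst⟩, hu.2⟩, fun hu => ⟨⟨hu.1.1, ?_⟩, hu.2⟩⟩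
  by_contra! hsu
  exact absurd (h u ⟨hsu.le, hu.1.2⟩) (not_le.2 (hu.2.trans hε.2))

/-- Every level below `ℓ y t` is attained by the local time at `y` at a time before `t` when `B`
is at `y`. -/
theorem exists_eq_of_lt (hocc : OccupationDensity B ℓ) (hB : ContinuousOn B (Ici 0))
    (hℓcont : ContinuousOn (fun p : ℝ × ℝ => ℓ p.1 p.2) (univ ×ˢ Ici 0))
    {y s t : ℝ} (ht : 0 ≤ t) (hs : 0 ≤ s) (hst : s < ℓ y t) :
    ∃ u ∈ Icc 0 t, B u = y ∧ ℓ y u = s := by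
  have hc : ContinuousOn (ℓ y) (Icc 0 t) :=
    hℓcont.comp (f := fun u : ℝ => (y, u)) (by fun_prop) fun u hu => ⟨mem_univ _, hu.1⟩
  have hK : IsCompact (Icc 0 t ∩ ℓ y ⁻¹' {s}) :=
    isCompact_Icc.of_isClosed_subset (hc.preimage_isClosed_of_isClosed isClosed_Icc
      isClosed_singleton) inter_subset_left
  obtain ⟨v, hv, hvs⟩ := intermediate_value_Icc ht hc ⟨by rw [hocc.apply_zero]; exact hs, hst.le⟩
  obtain ⟨u, ⟨hu, hus⟩, hmax⟩ := hK.exists_isGreatest ⟨v, hv, hvs⟩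
  have hus : ℓ y u = s := hus
  have hut : u < t := hu.2.lt_of_ne fun h => by rw [← h, hus] at hst; exact lt_irrefl _ hst
  refine ⟨u, hu, ?_, hus⟩
  by_contra hne
  have hpos : 0 < |B u - y| := abs_pos.2 (sub_ne_zero.2 hne)
  have hBu : ContinuousWithinAt (fun v => |B v - y|) (Ici u) u :=
    (((hB u hu.1).mono (Ici_subset_Ici.2 hu.1)).sub continuousWithinAt_const).abs
  have hev : ∀ᶠ v in nhdsWithin u (Ici u), |B u - y| / 2 < |B v - y| :=
    hBu.eventually (lt_mem_nhds (half_lt_self hpos))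
  obtain ⟨w, hw, hIcc⟩ := (mem_nhdsGE_iff_exists_Icc_subset).1 hev
  have hw : u < w := hw
  have hm : u < min w t := lt_min hw hut
  have heq : ℓ y (min w t) = s := by
    rw [← hus]
    exact hocc.eq_of_le_abs_sub hu.1 hm.le (half_pos hpos) fun v hv =>
      (hIcc ⟨hv.1, hv.2.trans (min_le_left _ _)⟩).le
  exact hm.not_ge (hmax ⟨⟨hu.1.trans hm.le, min_le_right _ _⟩, heq⟩)

end OccupationDensity

theorem lintegral_comp_div {f : ℝ → ENNReal} (hf : Measurable f) {c : ℝ} (hc : c ≠ 0) :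
    ∫⁻ x, f (x / c) = ENNReal.ofReal |c| * ∫⁻ x, f x := by
  conv_lhs => rw [← Real.smul_map_volume_mul_left hc]
  rw [lintegral_smul_measure, lintegral_map (by fun_prop) (by fun_prop), smul_eq_mul]
  simp_rw [mul_div_cancel_left₀ _ hc]

theorem volume_region_zero_co {f : ℝ → ℝ} (hf : Measurable f) :
    volume {p : ℝ × ℝ | p.2 ∈ Ico 0 (f p.1)} = ∫⁻ x, ENNReal.ofReal (f x) := by
  have hm : MeasurableSet {p : ℝ × ℝ | p.2 ∈ Ico 0 (f p.1)} :=
    (measurableSet_le measurable_const measurable_snd).inter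
      (measurableSet_lt measurable_snd (hf.comp measurable_fst))
  rw [Measure.volume_eq_prod, Measure.prod_apply hm]
  refine lintegral_congr fun x => ?_
  change volume (Ico 0 (f x)) = _
  simp

theorem volume_region_zero_cc {f : ℝ → ℝ} (hf : Measurable f) :
    volume {p : ℝ × ℝ | p.2 ∈ Icc 0 (f p.1)} = ∫⁻ x, ENNReal.ofReal (f x) := by
  have hm : MeasurableSet {p : ℝ × ℝ | p.2 ∈ Icc 0 (f p.1)} :=
    (measurableSet_le measurable_const measurable_snd).inter
      (measurableSet_le measurable_snd (hf.comp measurable_fst))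
  rw [Measure.volume_eq_prod, Measure.prod_apply hm]
  refine lintegral_congr fun x => ?_
  change volume (Icc 0 (f x)) = _
  simp

theorem scaled_bricklayer_space_filling
    (B : ℝ → ℝ) (ℓ : ℝ → ℝ → ℝ)
    (hB : ContinuousOn B (Ici 0))
    (hℓnn : ∀ y t : ℝ, 0 ≤ t → 0 ≤ ℓ y t)
    (hℓcont : ContinuousOn (fun p : ℝ × ℝ => ℓ p.1 p.2) (univ ×ˢ Ici 0))
    (hocc : OccupationDensity B ℓ)
    (hunb : ∀ y M : ℝ, ∃ t : ℝ, 0 ≤ t ∧ M < ℓ y t)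
    (c d : ℝ) (hc : c ≠ 0) (hd : 0 < d) :
    ContinuousOn (fun t => (c * B t, d * ℓ (B t) t)) (Ici 0) ∧
      (fun t => (c * B t, d * ℓ (B t) t)) '' Ici 0 = univ ×ˢ Ici 0 ∧
      (OccupationMeasureDensity B ℓ → ∀ t : ℝ, 0 ≤ t →
        volume ((fun u => (c * B u, d * ℓ (B u) u)) '' Icc 0 t)
          = ENNReal.ofReal (|c| * d * t)) := by
  have attain : ∀ {t x z : ℝ}, 0 ≤ t → 0 ≤ z → z < d * ℓ (x / c) t →
      ∃ u ∈ Icc 0 t, (c * B u, d * ℓ (B u) u) = (x, z) := by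
    intro t x z ht hz hzt
    obtain ⟨u, hu, hBu, hℓu⟩ := hocc.exists_eq_of_lt hB hℓcont (y := x / c) (s := z / d) ht
      (by positivity) ((div_lt_iff₀' hd).2 hzt)
    refine ⟨u, hu, ?_⟩
    rw [hBu, hℓu, mul_div_cancel₀ _ hc, mul_div_cancel₀ _ hd.ne']
  refine ⟨?_, ?_, fun hdens t ht => ?_⟩
  · exact (continuousOn_const.mul hB).prodMk (continuousOn_const.mul
      (hℓcont.comp (hB.prodMk continuousOn_id) fun t ht => ⟨mem_univ _, ht⟩))
  · refine Subset.antisymm ?_ ?_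
    · rintro _ ⟨t, ht, rfl⟩
      exact ⟨mem_univ _, mul_nonneg hd.le (hℓnn _ _ ht)⟩
    · rintro ⟨x, z⟩ ⟨-, hz⟩
      obtain ⟨t, ht, hzt⟩ := hunb (x / c) (z / d)
      obtain ⟨u, hu, h⟩ := attain ht hz ((div_lt_iff₀' hd).1 hzt)
      exact ⟨u, hu.1, h⟩
  · have hcont : Continuous fun y => ℓ y t := continuousOn_univ.1 <|
      hℓcont.comp (f := fun y : ℝ => (y, t)) (by fun_prop) fun y _ => ⟨mem_univ _, ht⟩
    have hmeas : Measurable fun x => d * ℓ (x / c) t :=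
      (hcont.measurable.comp (measurable_id.div_const c)).const_mul d
    have harea : ∫⁻ x, ENNReal.ofReal (d * ℓ (x / c) t) = ENNReal.ofReal (|c| * d * t) := by
      have htotal : ∫⁻ y, ENNReal.ofReal (ℓ y t) = ENNReal.ofReal t := by
        have h := hdens t ht univ MeasurableSet.univ
        simp only [mem_univ, and_true, Set.ofPred_mem_eq, Measure.restrict_univ, Real.volume_Icc,
          sub_zero] at h
        exact h.symm
      rw [lintegral_comp_div (f := fun y => ENNReal.ofReal (d * ℓ y t))
        (hcont.measurable.const_mul d).ennreal_ofReal hc]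
      simp_rw [ENNReal.ofReal_mul hd.le]
      rw [lintegral_const_mul _ hcont.measurable.ennreal_ofReal, htotal,
        ENNReal.ofReal_mul (by positivity), ENNReal.ofReal_mul (abs_nonneg c), mul_assoc]
    refine le_antisymm ?_ ?_
    · rw [← harea, ← volume_region_zero_cc hmeas]
      refine measure_mono ?_
      rintro _ ⟨u, hu, rfl⟩
      refine ⟨mul_nonneg hd.le (hℓnn _ _ hu.1), ?_⟩
      change d * ℓ (B u) u ≤ d * ℓ (c * B u / c) t
      rw [mul_div_cancel_left₀ _ hc]
      exact mul_le_mul_of_nonneg_left (hocc.mono _ hu.1 hu.2) hd.le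
    · rw [← harea, ← volume_region_zero_co hmeas]
      refine measure_mono ?_
      rintro ⟨x, z⟩ ⟨hz, hzt⟩
      exact attain ht hz hzt
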